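/- Let d ≥ 2, let 0 < r_1 < ... < r_N, and let F ∈ C^2 of the closed annulus {r_1 ≤ |x| ≤ r_N} in ℝ^d. Suppose I_2(F) is a harmonic spline for the partition A(r_1,r_2),...,A(r_{N-1},r_N) interpolating F on every sphere |x| = r_j, j = 1,...,N. Then the L^2 error estimate holds: ‖F - I_2(F)‖_{L^2(A(r_1,r_N))} ≤ C_d · max_{j=1,...,N-1} (r_{j+1} - r_j)^2 · ‖ΔF‖_{L^2(A(r_1,r_N))}, where C_d = max{1/(2d), 1/8} and ‖g‖_{L^2(Ω)} = (∫_Ω |g(x)|^2 dx)^{1/2}. -/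

import Mathlib

open MeasureTheory Metric Set Filter Topology

noncomputable section

/-- The Laplace operator `Δf = ∑ ∂²f/∂xᵢ²` on `ℝᵈ`. -/
def laplacian {d : ℕ} {V : Type*} [NormedAddCommGroup V] [NormedSpace ℝ V]
    (f : EuclideanSpace ℝ (Fin d) → V) (x : EuclideanSpace ℝ (Fin d)) : V :=
  ∑ i : Fin d, iteratedFDeriv ℝ 2 f x ![EuclideanSpace.single i 1, EuclideanSpace.single i 1]

/-- The open annulus `A(r,R) = {x ∈ ℝᵈ : r < |x| < R}`. -/
def annulus (d : ℕ) (r R : ℝ) : Set (EuclideanSpace ℝ (Fin d)) := {x | r < ‖x‖ ∧ ‖x‖ < R}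

/-- The closed annulus `{x ∈ ℝᵈ : r ≤ |x| ≤ R}`. -/
def closedAnnulus (d : ℕ) (r R : ℝ) : Set (EuclideanSpace ℝ (Fin d)) := {x | r ≤ ‖x‖ ∧ ‖x‖ ≤ R}

/-- A function is harmonic on an open set `U` if it is `C²` there and `Δf = 0` on `U`. -/
def HarmonicOn {d : ℕ} (f : EuclideanSpace ℝ (Fin d) → ℝ)
    (U : Set (EuclideanSpace ℝ (Fin d))) : Prop :=
  ContDiffOn ℝ 2 f U ∧ ∀ x ∈ U, laplacian f x = 0

/-- A harmonic spline for the partition `A(r 0, r 1), ..., A(r (n-1), r n)`: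
continuous on the closed annulus and harmonic on each open subannulus. -/
def HarmonicSpline (d n : ℕ) (r : Fin (n + 1) → ℝ)
    (S : EuclideanSpace ℝ (Fin d) → ℝ) : Prop :=
  ContinuousOn S (closedAnnulus d (r 0) (r (Fin.last n))) ∧
  ∀ i : Fin n, HarmonicOn S (annulus d (r i.castSucc) (r i.succ))


/-- The integral of a directional derivative of a compactly supported `C¹` function vanishes. -/
lemma integral_fderiv_apply_eq_zero {d : ℕ} {W : EuclideanSpace ℝ (Fin d) → ℝ}
    (hW : ContDiff ℝ 1 W) (hc : HasCompactSupport W) (v : EuclideanSpace ℝ (Fin d)) :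
    Integrable (fun x => fderiv ℝ W x v) ∧ ∫ x, fderiv ℝ W x v = 0 := by
  have hcont : Continuous (fun x => fderiv ℝ W x v) :=
    (hW.continuous_fderiv one_ne_zero).clm_apply continuous_const
  have hint : Integrable (fun x => fderiv ℝ W x v) :=
    hcont.integrable_of_hasCompactSupport (hc.fderiv_apply ℝ v)
  refine ⟨hint, ?_⟩
  have h := integral_mul_fderiv_eq_neg_fderiv_mul_of_integrable (μ := volume)
    (f := fun _ : EuclideanSpace ℝ (Fin d) => (1 : ℝ)) (g := W) (v := v) (by simp)
    (by simpa using hint)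
    (by simpa using hW.continuous.integrable_of_hasCompactSupport hc)
    (fun x _ => by fun_prop) (fun x _ => (hW.differentiable one_ne_zero) x)
  simpa using h

lemma laplacian_eq_sum_fderiv {d : ℕ} (f : EuclideanSpace ℝ (Fin d) → ℝ)
    (x : EuclideanSpace ℝ (Fin d)) :
    laplacian f x = ∑ i : Fin d, fderiv ℝ (fderiv ℝ f) x (EuclideanSpace.single i 1)
      (EuclideanSpace.single i 1) := by
  simp [laplacian, iteratedFDeriv_two_apply]

lemma ContDiffAt.hasFDerivAt_fderiv_apply {d : ℕ} {f : EuclideanSpace ℝ (Fin d) → ℝ}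
    {x : EuclideanSpace ℝ (Fin d)} (hf : ContDiffAt ℝ 2 f x) (e : EuclideanSpace ℝ (Fin d)) :
    HasFDerivAt (fun y => fderiv ℝ f y e) ((fderiv ℝ (fderiv ℝ f) x).flip e) x := by
  have h1 : ContDiffAt ℝ 1 (fderiv ℝ f) x := hf.fderiv_right (by norm_num)
  have h2 := (h1.differentiableAt one_ne_zero).hasFDerivAt
  simpa using h2.clm_apply (hasFDerivAt_const e x)

lemma ContDiffAt.fderiv_apply_one {d : ℕ} {f : EuclideanSpace ℝ (Fin d) → ℝ}
    {x : EuclideanSpace ℝ (Fin d)} (hf : ContDiffAt ℝ 2 f x) (e : EuclideanSpace ℝ (Fin d)) :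
    ContDiffAt ℝ 1 (fun y => fderiv ℝ f y e) x :=
  (hf.fderiv_right (m := 1) (by norm_num)).clm_apply contDiffAt_const

/-- The divergence of `β(u/φ) (φ ∇u - u ∇φ)`, one coordinate at a time. -/
lemma fderiv_comp_div_mul_wronskian {d : ℕ} {u φ : EuclideanSpace ℝ (Fin d) → ℝ} {β : ℝ → ℝ}
    {x : EuclideanSpace ℝ (Fin d)} (hu : ContDiffAt ℝ 2 u x) (hφ : ContDiffAt ℝ 2 φ x)
    (hx : φ x ≠ 0) (hβ : Differentiable ℝ β) (e : EuclideanSpace ℝ (Fin d)) :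
    fderiv ℝ (fun y => β (u y / φ y) * (φ y * fderiv ℝ u y e - u y * fderiv ℝ φ y e)) x e =
      deriv β (u x / φ x) * ((φ x * fderiv ℝ u x e - u x * fderiv ℝ φ x e) / φ x) ^ 2 +
      β (u x / φ x) * (φ x * fderiv ℝ (fderiv ℝ u) x e e -
        u x * fderiv ℝ (fderiv ℝ φ) x e e) := by
  have hu1 := (hu.differentiableAt two_ne_zero).hasFDerivAt
  have hφ1 := (hφ.differentiableAt two_ne_zero).hasFDerivAt
  have hu2 := hu.hasFDerivAt_fderiv_apply e
  have hφ2 := hφ.hasFDerivAt_fderiv_apply e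
  have hw := hu1.fun_mul ((hasDerivAt_inv hx).comp_hasFDerivAt x hφ1)
  have hβw := (hβ (u x / φ x)).hasDerivAt.comp_hasFDerivAt x
    (f := fun y => u y / φ y) (by simpa [div_eq_mul_inv, Function.comp_def] using hw)
  have h := hβw.fun_mul ((hφ1.fun_mul hu2).fun_sub (hu1.fun_mul hφ2))
  have h' := congrArg (fun L : EuclideanSpace ℝ (Fin d) →L[ℝ] ℝ => L e) h.fderiv
  simp only [Function.comp_def] at h'
  rw [h']
  simp
  field_simp
  ring

/-- Weak form of the supersolution comparison: for a monotone truncation `β` vanishing near `0`,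
the flux `β(u/φ) (φ ∇u - u ∇φ)` has compact support in `A`, so its divergence integrates
to zero. -/
lemma setIntegral_le_zero_of_le_truncated {d : ℕ} {A K : Set (EuclideanSpace ℝ (Fin d))}
    (hA : IsOpen A) (hK : IsCompact K) (hAK : A ⊆ K) {u φ : EuclideanSpace ℝ (Fin d) → ℝ}
    (hu : ContDiffOn ℝ 2 u A) (hφ : ContDiffOn ℝ 2 φ A)
    (huK : ContinuousOn u K) (hφK : ContinuousOn φ K) (hpos : ∀ x ∈ K, 0 < φ x)
    (hu0 : ∀ x ∈ K, x ∉ A → u x = 0)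
    {β : ℝ → ℝ} (hβ : ContDiff ℝ 1 β) (hmono : Monotone β) {ε : ℝ} (hε : 0 < ε)
    (hβ0 : ∀ t, |t| < ε → β t = 0) {G : EuclideanSpace ℝ (Fin d) → ℝ}
    (hG : IntegrableOn G A)
    (hGle : ∀ x ∈ A, G x ≤ β (u x / φ x) * (φ x * laplacian u x - u x * laplacian φ x)) :
    ∫ x in A, G x ≤ 0 := by
  classical
  let V : Fin d → EuclideanSpace ℝ (Fin d) → ℝ := fun i y =>
    β (u y / φ y) * (φ y * fderiv ℝ u y (EuclideanSpace.single i 1) -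
      u y * fderiv ℝ φ y (EuclideanSpace.single i 1))
  let W : Fin d → EuclideanSpace ℝ (Fin d) → ℝ := fun i => A.indicator (V i)
  have hwK : ContinuousOn (fun x => |u x / φ x|) K :=
    (huK.div hφK fun x hx => (hpos x hx).ne').abs
  have hK' : IsCompact (K ∩ (fun x => |u x / φ x|) ⁻¹' Ici ε) :=
    hK.of_isClosed_subset (hwK.preimage_isClosed_of_isClosed hK.isClosed isClosed_Ici)
      inter_subset_left
  set K' := K ∩ (fun x => |u x / φ x|) ⁻¹' Ici ε
  have hW0 : ∀ i, ∀ x ∉ K', W i x = 0 := by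
    intro i x hx
    by_cases hxA : x ∈ A
    · have : |u x / φ x| < ε := by
        by_contra h
        exact hx ⟨hAK hxA, not_lt.1 h⟩
      simp [W, V, hβ0 _ this]
    · simp [W, hxA]
  have hK'A : K' ⊆ A := by
    intro x hx
    by_contra hxA
    have := hx.2
    simp [hu0 x hx.1 hxA] at this
    linarith
  have hWev : ∀ i, ∀ x ∉ A, W i =ᶠ[𝓝 x] fun _ => 0 := by
    intro i x hx
    filter_upwards [hK'.isClosed.isOpen_compl.mem_nhds (fun h => hx (hK'A h))] with y hy
    exact hW0 i y hy
  have hWevA : ∀ i, ∀ x ∈ A, W i =ᶠ[𝓝 x] V i := by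
    intro i x hx
    filter_upwards [hA.mem_nhds hx] with y hy
    simp [W, hy]
  have huA : ∀ x ∈ A, ContDiffAt ℝ 2 u x := fun x hx => hu.contDiffAt (hA.mem_nhds hx)
  have hφA : ∀ x ∈ A, ContDiffAt ℝ 2 φ x := fun x hx => hφ.contDiffAt (hA.mem_nhds hx)
  have hWsm : ∀ i, ContDiff ℝ 1 (W i) := by
    intro i
    rw [contDiff_iff_contDiffAt]
    intro x
    by_cases hx : x ∈ A
    · refine ContDiffAt.congr_of_eventuallyEq ?_ (hWevA i x hx)
      have hu' : ContDiffAt ℝ 1 u x := (huA x hx).of_le (by norm_num)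
      have hφ' : ContDiffAt ℝ 1 φ x := (hφA x hx).of_le (by norm_num)
      exact (hβ.contDiffAt.comp x (hu'.div hφ' (hpos x (hAK hx)).ne')).mul
        ((hφ'.mul ((huA x hx).fderiv_apply_one _)).sub (hu'.mul ((hφA x hx).fderiv_apply_one _)))
    · exact contDiffAt_const.congr_of_eventuallyEq (hWev i x hx)
  have hWc : ∀ i, HasCompactSupport (W i) := fun i => HasCompactSupport.intro hK' (hW0 i)
  have hI := fun i => integral_fderiv_apply_eq_zero (hWsm i) (hWc i) (EuclideanSpace.single i 1)
  have hle : ∀ x, A.indicator G x ≤ ∑ i, fderiv ℝ (W i) x (EuclideanSpace.single i 1) := by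
    intro x
    by_cases hx : x ∈ A
    · rw [indicator_of_mem hx]
      refine (hGle x hx).trans ?_
      rw [laplacian_eq_sum_fderiv, laplacian_eq_sum_fderiv, Finset.mul_sum, Finset.mul_sum,
        ← Finset.sum_sub_distrib, Finset.mul_sum]
      refine Finset.sum_le_sum fun i _ => ?_
      rw [(hWevA i x hx).fderiv_eq, fderiv_comp_div_mul_wronskian (huA x hx) (hφA x hx)
        (hpos x (hAK hx)).ne' (hβ.differentiable one_ne_zero)]
      have := mul_nonneg (hmono.deriv_nonneg (x := u x / φ x))
        (sq_nonneg ((φ x * fderiv ℝ u x (EuclideanSpace.single i 1) -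
          u x * fderiv ℝ φ x (EuclideanSpace.single i 1)) / φ x))
      linarith
    · rw [indicator_of_notMem hx]
      refine (Finset.sum_eq_zero fun i _ => ?_).ge
      rw [(hWev i x hx).fderiv_eq]
      simp
  rw [← integral_indicator hA.measurableSet]
  calc ∫ x, A.indicator G x
      ≤ ∫ x, ∑ i, fderiv ℝ (W i) x (EuclideanSpace.single i 1) :=
        integral_mono ((integrable_indicator_iff hA.measurableSet).2 hG)
          (integrable_finsetSum _ fun i _ => (hI i).1) hle
    _ = 0 := by
        rw [integral_finsetSum _ fun i _ => (hI i).1]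
        exact Finset.sum_eq_zero fun i _ => (hI i).2

/-- A smooth monotone truncation of the identity which vanishes near the origin. -/
def truncation (N t : ℝ) : ℝ := t * Real.smoothTransition ((N * t) ^ 2 - 1)

lemma contDiff_truncation (N : ℝ) : ContDiff ℝ 1 (truncation N) := by
  unfold truncation
  exact contDiff_id.mul (Real.smoothTransition.contDiff.comp (by fun_prop))

lemma monotone_truncation (N : ℝ) : Monotone (truncation N) := by
  refine monotone_of_odd_of_monotoneOn_nonneg (fun t => by simp [truncation]) ?_
  intro s hs t ht hst
  have hs' : 0 ≤ s := hs
  have hsq : (N * s) ^ 2 ≤ (N * t) ^ 2 := by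
    rw [mul_pow, mul_pow]
    gcongr
  exact mul_le_mul hst (Real.smoothTransition.monotone (by linarith))
    (Real.smoothTransition.nonneg _) (hs'.trans hst)

lemma truncation_eq_zero {N t : ℝ} (hN : 0 < N) (ht : |t| < 1 / N) : truncation N t = 0 := by
  have h : |N * t| < 1 := by
    rw [abs_mul, abs_of_pos hN]
    rwa [lt_div_iff₀' hN] at ht
  have h2 : (N * t) ^ 2 < 1 := by rwa [sq_lt_one_iff_abs_lt_one]
  rw [truncation, Real.smoothTransition.zero_of_nonpos (by linarith), mul_zero]

lemma tendsto_smoothTransition_truncation {w : ℝ} (hw : w ≠ 0) :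
    Tendsto (fun n : ℕ => Real.smoothTransition ((((n : ℝ) + 1) * w) ^ 2 - 1)) atTop (𝓝 1) := by
  have h1 : Tendsto (fun n : ℕ => ((n : ℝ) + 1) * |w|) atTop atTop :=
    (tendsto_atTop_add_const_right _ _ tendsto_natCast_atTop_atTop).atTop_mul_const
      (abs_pos.2 hw)
  refine tendsto_const_nhds.congr' ?_
  filter_upwards [h1.eventually_ge_atTop 2] with n hn
  rw [Real.smoothTransition.one_of_one_le]
  have : (((n : ℝ) + 1) * w) ^ 2 = (((n : ℝ) + 1) * |w|) ^ 2 := by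
    rw [mul_pow, mul_pow, sq_abs]
  nlinarith

/-- If a positive `φ` satisfies `Δφ ≤ -lam φ`, then `lam ‖u‖ ≤ ‖Δu‖` in `L²`
for every `u` vanishing on the boundary. -/
lemma sq_mul_setIntegral_sq_le {d : ℕ} {A K : Set (EuclideanSpace ℝ (Fin d))}
    (hA : IsOpen A) (hK : IsCompact K) (hAK : A ⊆ K) {u φ : EuclideanSpace ℝ (Fin d) → ℝ}
    (hu : ContDiffOn ℝ 2 u A) (hφ : ContDiffOn ℝ 2 φ A)
    (huK : ContinuousOn u K) (hφK : ContinuousOn φ K) (hpos : ∀ x ∈ K, 0 < φ x)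
    (hu0 : ∀ x ∈ K, x ∉ A → u x = 0) {lam : ℝ} (hlam : 0 < lam)
    (hsuper : ∀ x ∈ A, laplacian φ x ≤ -lam * φ x)
    (hg : IntegrableOn (fun x => laplacian u x ^ 2) A) :
    lam ^ 2 * ∫ x in A, u x ^ 2 ≤ ∫ x in A, laplacian u x ^ 2 := by
  let σ : ℕ → EuclideanSpace ℝ (Fin d) → ℝ := fun n x =>
    Real.smoothTransition ((((n : ℝ) + 1) * (u x / φ x)) ^ 2 - 1)
  have hσ0 : ∀ n x, 0 ≤ σ n x := fun n x => Real.smoothTransition.nonneg _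
  have hσ1 : ∀ n x, σ n x ≤ 1 := fun n x => Real.smoothTransition.le_one _
  have huint : IntegrableOn (fun x => u x ^ 2) A :=
    ((huK.pow 2).integrableOn_compact hK).mono_set hAK
  have hσc : ∀ n, ContinuousOn (σ n) K := fun n =>
    Real.smoothTransition.continuous.comp_continuousOn
      (((continuousOn_const.mul (huK.div hφK fun x hx => (hpos x hx).ne')).pow 2).sub
        continuousOn_const)
  have hσint : ∀ n, IntegrableOn (fun x => σ n x * u x ^ 2) A := fun n =>
    (((hσc n).mul (huK.pow 2)).integrableOn_compact hK).mono_set hAK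
  have hn : ∀ n : ℕ, lam ^ 2 * ∫ x in A, σ n x * u x ^ 2 ≤ ∫ x in A, laplacian u x ^ 2 := by
    intro n
    have hN : (0 : ℝ) < (n : ℝ) + 1 := by positivity
    have h : ∫ x in A, (lam / 2 * (σ n x * u x ^ 2) - laplacian u x ^ 2 / (2 * lam)) ≤ 0 := by
      refine setIntegral_le_zero_of_le_truncated hA hK hAK hu hφ huK hφK hpos hu0
        (contDiff_truncation ((n : ℝ) + 1)) (monotone_truncation _) (one_div_pos.2 hN)
        (fun t ht => truncation_eq_zero hN ht)
        (((hσint n).const_mul _).sub (hg.div_const _)) ?_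
      intro x hx
      have hφx := hpos x (hAK hx)
      have h1 : truncation ((n : ℝ) + 1) (u x / φ x) *
          (φ x * laplacian u x - u x * laplacian φ x) =
          σ n x * (u x * laplacian u x - u x ^ 2 * (laplacian φ x / φ x)) := by
        simp only [truncation, σ]
        field_simp
      have h2 : laplacian φ x / φ x ≤ -lam := (div_le_iff₀ hφx).2 (hsuper x hx)
      have h3 : laplacian u x ^ 2 / (2 * lam) * σ n x ≤ laplacian u x ^ 2 / (2 * lam) :=
        mul_le_of_le_one_right (by positivity) (hσ1 n x)
      have h4 : 0 ≤ u x * laplacian u x + lam / 2 * u x ^ 2 + laplacian u x ^ 2 / (2 * lam) := by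
        have : u x * laplacian u x + lam / 2 * u x ^ 2 + laplacian u x ^ 2 / (2 * lam) =
            (lam * u x + laplacian u x) ^ 2 / (2 * lam) := by
          field_simp
          ring
        rw [this]
        positivity
      rw [h1]
      have h5 : u x ^ 2 * (laplacian φ x / φ x) ≤ u x ^ 2 * -lam :=
        mul_le_mul_of_nonneg_left h2 (sq_nonneg _)
      have h6 := mul_nonneg (hσ0 n x) h4
      have h7 := mul_le_mul_of_nonneg_left h5 (hσ0 n x)
      linarith
    rw [integral_sub ((hσint n).const_mul _) (hg.div_const _), integral_const_mul,
      integral_div, sub_nonpos, le_div_iff₀ (by positivity)] at h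
    linarith
  have hlim : Tendsto (fun n => ∫ x in A, σ n x * u x ^ 2) atTop (𝓝 (∫ x in A, u x ^ 2)) := by
    refine tendsto_integral_of_dominated_convergence (fun x => u x ^ 2)
      (fun n => (hσint n).aestronglyMeasurable) huint ?_ ?_
    · intro n
      refine Eventually.of_forall fun x => ?_
      rw [Real.norm_of_nonneg (mul_nonneg (hσ0 n x) (sq_nonneg _))]
      exact mul_le_of_le_one_left (sq_nonneg _) (hσ1 n x)
    · refine (ae_restrict_iff' hA.measurableSet).2 (Eventually.of_forall fun x hx => ?_)
      by_cases hux : u x = 0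
      · simp [hux]
      · have := (tendsto_smoothTransition_truncation
          (div_ne_zero hux (hpos x (hAK hx)).ne')).mul_const (u x ^ 2)
        simpa [σ] using this
  exact le_of_tendsto (hlim.const_mul _) (Eventually.of_forall hn)

lemma hasFDerivAt_norm_of_ne_zero {d : ℕ} {x : EuclideanSpace ℝ (Fin d)} (hx : x ≠ 0) :
    HasFDerivAt (fun y : EuclideanSpace ℝ (Fin d) => ‖y‖) (‖x‖⁻¹ • innerSL ℝ x) x := by
  have hx' : ‖x‖ ≠ 0 := norm_ne_zero_iff.2 hx
  have h := (hasStrictFDerivAt_norm_sq x).hasFDerivAt.sqrt (pow_ne_zero 2 hx')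
  simp only [Real.sqrt_sq (norm_nonneg _)] at h
  refine h.congr_fderiv (ContinuousLinearMap.ext fun y => ?_)
  have e1 : (‖x‖⁻¹ • innerSL ℝ x) y = ‖x‖⁻¹ * inner ℝ x y := rfl
  have e2 : ((1 / (2 * ‖x‖)) • 2 • innerSL ℝ x) y = 1 / (2 * ‖x‖) * (2 • inner ℝ x y) := rfl
  rw [e1, e2, nsmul_eq_mul]
  field_simp
  simp

/-- The Laplacian of a radial function `q(|x|)` is `q'' + (d - 1) q' / |x|`. -/
lemma laplacian_radial {d : ℕ} {q q₁ : ℝ → ℝ} {q₂ : ℝ} {x : EuclideanSpace ℝ (Fin d)}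
    (hx : x ≠ 0) (h₁ : ∀ ρ, 0 < ρ → HasDerivAt q (q₁ ρ) ρ) (h₂ : HasDerivAt q₁ q₂ ‖x‖) :
    laplacian (fun y => q ‖y‖) x = q₂ + (d - 1) / ‖x‖ * q₁ ‖x‖ := by
  have hx' : ‖x‖ ≠ 0 := norm_ne_zero_iff.2 hx
  have hfd : fderiv ℝ (fun y : EuclideanSpace ℝ (Fin d) => q ‖y‖) =ᶠ[𝓝 x]
      fun y => (q₁ ‖y‖ / ‖y‖) • innerSL ℝ y := by
    filter_upwards [isOpen_ne.mem_nhds hx] with y hy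
    have h := (h₁ ‖y‖ (norm_pos_iff.2 hy)).comp_hasFDerivAt y (hasFDerivAt_norm_of_ne_zero hy)
    have h' := h.fderiv
    simp only [Function.comp_def] at h'
    rw [h', smul_smul, div_eq_mul_inv]
  have hk : HasDerivAt (fun ρ => q₁ ρ / ρ) ((q₂ * ‖x‖ - q₁ ‖x‖ * 1) / ‖x‖ ^ 2) ‖x‖ :=
    h₂.fun_div (hasDerivAt_id' _) hx'
  have hk' := (hk.comp_hasFDerivAt x (hasFDerivAt_norm_of_ne_zero hx)).fun_smul
    (innerSL ℝ (E := EuclideanSpace ℝ (Fin d))).hasFDerivAt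
  have hterm : ∀ i : Fin d, fderiv ℝ (fderiv ℝ (fun y : EuclideanSpace ℝ (Fin d) => q ‖y‖)) x
      (EuclideanSpace.single i 1) (EuclideanSpace.single i 1) =
      q₁ ‖x‖ / ‖x‖ + (q₂ * ‖x‖ - q₁ ‖x‖) / ‖x‖ ^ 3 * (x i) ^ 2 := by
    intro i
    rw [hfd.fderiv_eq]
    have h := hk'.fderiv
    simp only [Function.comp_def] at h
    have e : ∀ y : EuclideanSpace ℝ (Fin d),
        innerSL ℝ y (EuclideanSpace.single i 1) = y i := fun y => by
      rw [innerSL_apply_apply, EuclideanSpace.inner_single_right]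
      simp
    rw [h]
    simp [e]
    field_simp
  rw [laplacian_eq_sum_fderiv, Finset.sum_congr rfl fun i _ => hterm i, Finset.sum_add_distrib,
    ← Finset.mul_sum, ← EuclideanSpace.real_norm_sq_eq]
  simp
  field_simp
  ring

lemma ContDiffOn.comp_norm {d : ℕ} {q : ℝ → ℝ} (hq : ContDiffOn ℝ 2 q (Ioi 0)) :
    ContDiffOn ℝ 2 (fun y : EuclideanSpace ℝ (Fin d) => q ‖y‖) {0}ᶜ := by
  intro x hx
  refine ContDiffAt.contDiffWithinAt ?_
  exact (hq.contDiffAt (Ioi_mem_nhds (norm_pos_iff.2 hx))).comp x (contDiffAt_norm ℝ hx)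

/-- In the plane, a function with constant Laplacian `-4`, positive on the closed annulus and
bounded by `(b - a) ^ 2`. -/
lemma exists_supersolution_two {a b : ℝ} (ha : 0 < a) (hab : a < b) :
    ∃ φ : EuclideanSpace ℝ (Fin 2) → ℝ, ContDiffOn ℝ 2 φ {0}ᶜ ∧
      (∀ x ∈ closedAnnulus 2 a b, 0 < φ x) ∧
      ∀ x ∈ annulus 2 a b, laplacian φ x ≤ -(4 / (b - a) ^ 2) * φ x := by
  have hb : 0 < b := ha.trans hab
  have hh : 0 < b - a := sub_pos.2 hab
  let q : ℝ → ℝ := fun ρ => (b - a) ^ 2 + a * b - ρ ^ 2 +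
    a * b * (2 * Real.log ρ - Real.log (a * b))
  have hqlog : ∀ ρ, 0 < ρ → q ρ = (b - a) ^ 2 + a * b - ρ ^ 2 +
      a * b * Real.log (ρ ^ 2 / (a * b)) := by
    intro ρ hρ
    rw [Real.log_div (by positivity) (by positivity), Real.log_pow]
    simp [q]
  refine ⟨fun x => q ‖x‖, ContDiffOn.comp_norm ?_, ?_, ?_⟩
  · intro ρ hρ
    have : ContDiffAt ℝ 2 Real.log ρ := Real.contDiffAt_log.2 (ne_of_gt hρ)
    refine ContDiffAt.contDiffWithinAt ?_
    simp only [q]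
    fun_prop
  · intro x hx
    have hρ : 0 < ‖x‖ := ha.trans_le hx.1
    set ρ := ‖x‖
    have hρa : a ≤ ρ := hx.1
    have hρb : ρ ≤ b := hx.2
    change 0 < q ρ
    rw [hqlog ρ hρ]
    by_cases ht : ρ ^ 2 = a * b
    · rw [ht, div_self (by positivity)]
      simp
      positivity
    · have hlog : Real.log (a * b / ρ ^ 2) < a * b / ρ ^ 2 - 1 := by
        refine Real.log_lt_sub_one_of_pos (by positivity) fun h => ht ?_
        rw [div_eq_one_iff_eq (by positivity)] at h
        exact h.symm
      have hinv : Real.log (ρ ^ 2 / (a * b)) = -Real.log (a * b / ρ ^ 2) := by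
        rw [← Real.log_inv, inv_div]
      have hkey : (ρ - a * b / ρ) ^ 2 ≤ (b - a) ^ 2 := by
        apply sq_le_sq'
        · have : a * b / ρ ≤ b := by
            rw [div_le_iff₀ hρ]
            nlinarith
          linarith
        · have : a ≤ a * b / ρ := by
            rw [le_div_iff₀ hρ]
            nlinarith
          linarith
      have hexp : (ρ - a * b / ρ) ^ 2 = ρ ^ 2 - 2 * (a * b) + a * b * (a * b / ρ ^ 2) := by
        field_simp
        ring
      have hab' : 0 < a * b := by positivity
      have := mul_lt_mul_of_pos_left hlog hab'
      rw [hinv]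
      linarith
  · intro x hx
    have hρ : 0 < ‖x‖ := ha.trans hx.1
    have h₁ : ∀ ρ, 0 < ρ → HasDerivAt q (-2 * ρ + a * b * (2 * ρ⁻¹)) ρ := by
      intro ρ hρ
      have h := ((hasDerivAt_const ρ ((b - a) ^ 2 + a * b)).fun_sub
        ((hasDerivAt_id' ρ).fun_pow 2)).fun_add
        ((((Real.hasDerivAt_log hρ.ne').const_mul 2).sub_const (Real.log (a * b))).const_mul
          (a * b))
      exact h.congr_deriv (by simp)
    have h₂ : HasDerivAt (fun ρ => -2 * ρ + a * b * (2 * ρ⁻¹))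
        (-2 * 1 + a * b * (2 * (-(‖x‖ ^ 2)⁻¹))) ‖x‖ :=
      ((hasDerivAt_id' ‖x‖).const_mul (-2)).fun_add
        (((hasDerivAt_inv hρ.ne').const_mul 2).const_mul (a * b))
    rw [laplacian_radial (norm_pos_iff.1 hρ) h₁ h₂]
    have hlog := Real.log_le_sub_one_of_pos (x := ‖x‖ ^ 2 / (a * b)) (by positivity)
    have hle : q ‖x‖ ≤ (b - a) ^ 2 := by
      rw [hqlog _ hρ]
      have := mul_le_mul_of_nonneg_left hlog (mul_pos ha hb).le
      have he : a * b * (‖x‖ ^ 2 / (a * b) - 1) = ‖x‖ ^ 2 - a * b := by field_simp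
      linarith
    have h4 : 4 / (b - a) ^ 2 * q ‖x‖ ≤ 4 := by
      rw [div_mul_eq_mul_div, div_le_iff₀ (by positivity)]
      linarith
    have h5 : -2 * 1 + a * b * (2 * (-(‖x‖ ^ 2)⁻¹)) +
        (((2 : ℕ) : ℝ) - 1) / ‖x‖ * (-2 * ‖x‖ + a * b * (2 * ‖x‖⁻¹)) = -4 := by
      push_cast
      field_simp
      ring
    rw [h5]
    linarith

/-- In dimension at least three, `|x| ^ (-(d - 1) / 2) cos (√8 (|x| - (a + b) / 2) / (b - a))`
is a positive supersolution. -/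
lemma exists_supersolution_of_three_le {d : ℕ} (hd : 3 ≤ d) {a b : ℝ} (ha : 0 < a) (hab : a < b) :
    ∃ φ : EuclideanSpace ℝ (Fin d) → ℝ, ContDiffOn ℝ 2 φ {0}ᶜ ∧
      (∀ x ∈ closedAnnulus d a b, 0 < φ x) ∧
      ∀ x ∈ annulus d a b, laplacian φ x ≤ -(8 / (b - a) ^ 2) * φ x := by
  have hh : 0 < b - a := sub_pos.2 hab
  obtain ⟨κ, hκ⟩ : ∃ κ : ℝ, κ = ((d : ℝ) - 1) / 2 := ⟨_, rfl⟩
  have hκ1 : 1 ≤ κ := by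
    have : (3 : ℝ) ≤ d := by exact_mod_cast hd
    linarith
  obtain ⟨c, hc⟩ : ∃ c : ℝ, c = √8 / (b - a) := ⟨_, rfl⟩
  have hc2 : c ^ 2 = 8 / (b - a) ^ 2 := by
    rw [hc, div_pow, Real.sq_sqrt (by norm_num)]
  let m : ℝ := (a + b) / 2
  let E : ℝ → ℝ := fun ρ => Real.exp (-κ * Real.log ρ)
  have hE : ∀ ρ, 0 < ρ → HasDerivAt E (E ρ * (-κ * ρ⁻¹)) ρ := fun ρ hρ =>
    ((Real.hasDerivAt_log hρ.ne').const_mul (-κ)).exp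
  have hlin : ∀ ρ, HasDerivAt (fun ρ => c * (ρ - m)) c ρ := fun ρ => by
    simpa using ((hasDerivAt_id' ρ).sub_const m).const_mul c
  have hcos : ∀ ρ, HasDerivAt (fun ρ => Real.cos (c * (ρ - m))) (-Real.sin (c * (ρ - m)) * c) ρ :=
    fun ρ => (hlin ρ).cos
  have hsin : ∀ ρ, HasDerivAt (fun ρ => Real.sin (c * (ρ - m))) (Real.cos (c * (ρ - m)) * c) ρ :=
    fun ρ => (hlin ρ).sin
  have hpos : ∀ x ∈ closedAnnulus d a b, 0 < E ‖x‖ * Real.cos (c * (‖x‖ - m)) := by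
    intro x hx
    refine mul_pos (Real.exp_pos _) (Real.cos_pos_of_mem_Ioo ?_)
    have h8 : √8 < 3 := by
      rw [Real.sqrt_lt' (by norm_num)]
      norm_num
    have hpi := Real.pi_gt_three
    have hcpos : 0 ≤ c := by rw [hc]; positivity
    have hch : c * ((b - a) / 2) = √8 / 2 := by
      rw [hc]
      field_simp
    have h1 : -((b - a) / 2) ≤ ‖x‖ - m := by
      have := hx.1
      simp only [m]
      linarith
    have h2 : ‖x‖ - m ≤ (b - a) / 2 := by
      have := hx.2
      simp only [m]
      linarith
    have h3 := mul_le_mul_of_nonneg_left h1 hcpos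
    have h4 := mul_le_mul_of_nonneg_left h2 hcpos
    constructor <;> linarith
  refine ⟨fun x => E ‖x‖ * Real.cos (c * (‖x‖ - m)),
    ContDiffOn.comp_norm (q := fun ρ => E ρ * Real.cos (c * (ρ - m))) ?_, hpos, ?_⟩
  · intro ρ hρ
    have : ContDiffAt ℝ 2 Real.log ρ := Real.contDiffAt_log.2 (ne_of_gt hρ)
    refine ContDiffAt.contDiffWithinAt ?_
    simp only [E]
    fun_prop
  · intro x hx
    have hρ : 0 < ‖x‖ := ha.trans hx.1
    have h₂ := (((hE ‖x‖ hρ).fun_mul ((hasDerivAt_inv hρ.ne').const_mul (-κ))).fun_mul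
      (hcos ‖x‖)).fun_add ((hE ‖x‖ hρ).fun_mul ((hsin ‖x‖).fun_neg.mul_const c))
    have hφ := hpos x ⟨hx.1.le, hx.2.le⟩
    rw [laplacian_radial (norm_pos_iff.1 hρ) (fun ρ hρ => (hE ρ hρ).fun_mul (hcos ρ)) h₂, ← hc2]
    have hd' : (d : ℝ) - 1 = 2 * κ := by
      rw [hκ]
      ring
    rw [hd']
    have hneg : 0 ≤ κ * (κ - 1) / ‖x‖ ^ 2 * (E ‖x‖ * Real.cos (c * (‖x‖ - m))) :=
      mul_nonneg (div_nonneg (mul_nonneg (by linarith) (by linarith)) (by positivity)) hφ.le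
    rw [← sub_nonneg]
    convert hneg using 1
    field_simp
    ring

/-- A positive supersolution on the annulus with the spectral constant of the error estimate. -/
lemma exists_supersolution {d : ℕ} (hd : 2 ≤ d) {a b : ℝ} (ha : 0 < a) (hab : a < b) :
    ∃ φ : EuclideanSpace ℝ (Fin d) → ℝ, ContDiffOn ℝ 2 φ {0}ᶜ ∧
      (∀ x ∈ closedAnnulus d a b, 0 < φ x) ∧
      ∀ x ∈ annulus d a b,
        laplacian φ x ≤ -(max (1 / (2 * (d : ℝ))) (1 / 8) * (b - a) ^ 2)⁻¹ * φ x := by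
  have hh : 0 < b - a := sub_pos.2 hab
  rcases hd.eq_or_lt with rfl | hd3
  · obtain ⟨φ, h1, h2, h3⟩ := exists_supersolution_two ha hab
    refine ⟨φ, h1, h2, fun x hx => (h3 x hx).trans_eq ?_⟩
    rw [max_eq_left (by norm_num)]
    congr 2
    field_simp
    norm_num
  · obtain ⟨φ, h1, h2, h3⟩ := exists_supersolution_of_three_le hd3 ha hab
    refine ⟨φ, h1, h2, fun x hx => (h3 x hx).trans ?_⟩
    refine mul_le_mul_of_nonneg_right (neg_le_neg ?_) (h2 x ⟨hx.1.le, hx.2.le⟩).le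
    have h8 : 8 / (b - a) ^ 2 = (1 / 8 * (b - a) ^ 2)⁻¹ := by
      field_simp
    rw [h8]
    gcongr
    exact le_max_right _ _

lemma isOpen_annulus (d : ℕ) (a b : ℝ) : IsOpen (annulus d a b) :=
  (isOpen_lt continuous_const continuous_norm).inter (isOpen_lt continuous_norm continuous_const)

lemma isCompact_closedAnnulus (d : ℕ) (a b : ℝ) : IsCompact (closedAnnulus d a b) :=
  (isCompact_closedBall 0 b).of_isClosed_subset
    ((isClosed_le continuous_const continuous_norm).inter
      (isClosed_le continuous_norm continuous_const))
    fun x hx => by simpa using hx.2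

lemma annulus_subset_closedAnnulus (d : ℕ) (a b : ℝ) : annulus d a b ⊆ closedAnnulus d a b :=
  fun _ hx => ⟨hx.1.le, hx.2.le⟩

lemma closedAnnulus_subset {d : ℕ} {a b a' b' : ℝ} (ha : a' ≤ a) (hb : b ≤ b') :
    closedAnnulus d a b ⊆ closedAnnulus d a' b' :=
  fun _ hx => ⟨ha.trans hx.1, hx.2.trans hb⟩

lemma ContDiffOn.continuousOn_laplacian {d : ℕ} {f : EuclideanSpace ℝ (Fin d) → ℝ}
    {A : Set (EuclideanSpace ℝ (Fin d))} (hf : ContDiffOn ℝ 2 f A) (hA : IsOpen A) :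
    ContinuousOn (laplacian f) A := by
  intro x hx
  have h2 : ContDiffAt ℝ 0 (fderiv ℝ (fderiv ℝ f)) x :=
    ((hf.contDiffAt (hA.mem_nhds hx)).fderiv_right (m := 1) (by norm_num)).fderiv_right
      (by norm_num)
  have h : ContinuousAt (fun y => ∑ i : Fin d, fderiv ℝ (fderiv ℝ f) y
      (EuclideanSpace.single i 1) (EuclideanSpace.single i 1)) x :=
    tendsto_finsetSum _ fun i _ =>
      (h2.continuousAt.clm_apply continuousAt_const).clm_apply continuousAt_const
  rw [show laplacian f = _ from funext (laplacian_eq_sum_fderiv f)]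
  exact h.continuousWithinAt

/-- A function which is `C²` up to the boundary of an open set with compact closure has bounded
Laplacian. -/
lemma ContDiffOn.exists_abs_laplacian_le {d : ℕ} {f : EuclideanSpace ℝ (Fin d) → ℝ}
    {A K : Set (EuclideanSpace ℝ (Fin d))} (hf : ContDiffOn ℝ 2 f K) (hA : IsOpen A)
    (hK : IsCompact K) (hAK : A ⊆ K) : ∃ M, ∀ x ∈ A, |laplacian f x| ≤ M := by
  suffices h : ∃ M, ∀ x ∈ K, x ∈ A → |laplacian f x| ≤ M by
    obtain ⟨M, hM⟩ := h
    exact ⟨M, fun x hx => hM x (hAK hx) hx⟩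
  refine hK.induction_on (p := fun s => ∃ M, ∀ x ∈ s, x ∈ A → |laplacian f x| ≤ M)
    ⟨0, by simp⟩ ?_ ?_ ?_
  · rintro s t hst ⟨M, hM⟩
    exact ⟨M, fun x hx => hM x (hst hx)⟩
  · rintro s t ⟨M, hM⟩ ⟨M', hM'⟩
    refine ⟨max M M', ?_⟩
    rintro x (hx | hx) hxA
    · exact (hM x hx hxA).trans (le_max_left _ _)
    · exact (hM' x hx hxA).trans (le_max_right _ _)
  · intro x hx
    obtain ⟨U, hU, p, hp⟩ := (hf x hx) 2 le_rfl
    rw [insert_eq_of_mem hx] at hU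
    have hxU : x ∈ U := mem_of_mem_nhdsWithin hx hU
    have hcont : ContinuousWithinAt (fun y => ∑ i : Fin d,
        p y 2 ![EuclideanSpace.single i 1, EuclideanSpace.single i 1]) U x := by
      refine tendsto_finsetSum _ fun i _ => ?_
      exact ((ContinuousMultilinearMap.apply ℝ _ ℝ _).continuous.tendsto _).comp
        (hp.cont 2 le_rfl x hxU)
    obtain ⟨M, hM⟩ := exists_gt |∑ i : Fin d,
      p x 2 ![EuclideanSpace.single i 1, EuclideanSpace.single i 1]|
    have hb := hcont.abs.eventually (eventually_lt_nhds hM)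
    have hb' := nhdsWithin_le_of_mem hU hb
    obtain ⟨O, hO, hxO, hOK⟩ := mem_nhdsWithin.1 (Filter.inter_mem hU hb')
    refine ⟨K ∩ O, inter_mem_nhdsWithin K (hO.mem_nhds hxO), M, fun y hy hyA => ?_⟩
    have hOA : IsOpen (O ∩ A) := hO.inter hA
    have hOU : O ∩ A ⊆ U := fun z hz => (hOK ⟨hz.1, hAK hz.2⟩).1
    have hyOA : y ∈ O ∩ A := ⟨hy.2, hyA⟩
    have heq := (hp.mono hOU).eq_iteratedFDerivWithin_of_uniqueDiffOn (m := 2) le_rfl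
      hOA.uniqueDiffOn hyOA
    rw [iteratedFDerivWithin_of_isOpen 2 hOA hyOA] at heq
    have hlt := (hOK hy.symm).2
    rw [laplacian, ← heq]
    exact le_of_lt hlt

lemma ContDiffOn.integrableOn_laplacian_sq {d : ℕ} {f : EuclideanSpace ℝ (Fin d) → ℝ}
    {A K : Set (EuclideanSpace ℝ (Fin d))} (hf : ContDiffOn ℝ 2 f K) (hA : IsOpen A)
    (hK : IsCompact K) (hAK : A ⊆ K) : IntegrableOn (fun x => laplacian f x ^ 2) A := by
  obtain ⟨M, hM⟩ := hf.exists_abs_laplacian_le hA hK hAK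
  refine IntegrableOn.of_bound ((measure_mono hAK).trans_lt hK.measure_lt_top)
    ((((hf.mono hAK).continuousOn_laplacian hA).pow 2).aestronglyMeasurable hA.measurableSet)
    (M ^ 2) ?_
  refine (ae_restrict_iff' hA.measurableSet).2 (Eventually.of_forall fun x hx => ?_)
  rw [norm_pow, Real.norm_eq_abs]
  exact pow_le_pow_left₀ (abs_nonneg _) (hM x hx) 2

lemma laplacian_sub {d : ℕ} {f g : EuclideanSpace ℝ (Fin d) → ℝ} {x : EuclideanSpace ℝ (Fin d)}
    (hf : ContDiffAt ℝ 2 f x) (hg : ContDiffAt ℝ 2 g x) :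
    laplacian (fun y => f y - g y) x = laplacian f x - laplacian g x := by
  simp only [laplacian]
  rw [← Finset.sum_sub_distrib]
  refine Finset.sum_congr rfl fun i _ => ?_
  rw [show (fun y => f y - g y) = f - g from rfl, iteratedFDeriv_sub_apply hf hg]
  rfl

/-- The error estimate on a single annulus. -/
lemma setIntegral_annulus_sq_sub_le {d : ℕ} (hd : 2 ≤ d) {a b : ℝ} (ha : 0 < a) (hab : a < b)
    {F S : EuclideanSpace ℝ (Fin d) → ℝ} (hF : ContDiffOn ℝ 2 F (closedAnnulus d a b))
    (hSc : ContinuousOn S (closedAnnulus d a b)) (hS : HarmonicOn S (annulus d a b))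
    (hSa : ∀ x, ‖x‖ = a → S x = F x) (hSb : ∀ x, ‖x‖ = b → S x = F x) :
    ∫ x in annulus d a b, (F x - S x) ^ 2 ≤
      (max (1 / (2 * (d : ℝ))) (1 / 8) * (b - a) ^ 2) ^ 2 *
        ∫ x in annulus d a b, laplacian F x ^ 2 := by
  have hA := isOpen_annulus d a b
  have hK := isCompact_closedAnnulus d a b
  have hAK := annulus_subset_closedAnnulus d a b
  obtain ⟨φ, hφ, hpos, hsuper⟩ := exists_supersolution hd ha hab
  have hK0 : closedAnnulus d a b ⊆ {0}ᶜ := by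
    intro x hx h0
    have h1 : a ≤ ‖x‖ := hx.1
    rw [mem_singleton_iff.1 h0, norm_zero] at h1
    linarith
  set c := max (1 / (2 * (d : ℝ))) (1 / 8) * (b - a) ^ 2
  have hc : 0 < c := by
    have := sub_pos.2 hab
    have : (0 : ℝ) < max (1 / (2 * (d : ℝ))) (1 / 8) := lt_max_of_lt_right (by norm_num)
    positivity
  have hlap : ∀ x ∈ annulus d a b, laplacian (fun y => F y - S y) x ^ 2 = laplacian F x ^ 2 := by
    intro x hx
    rw [laplacian_sub ((hF.mono hAK).contDiffAt (hA.mem_nhds hx))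
      (hS.1.contDiffAt (hA.mem_nhds hx)), hS.2 x hx, sub_zero]
  have hg := hF.integrableOn_laplacian_sq hA hK hAK
  have h := sq_mul_setIntegral_sq_le hA hK hAK (u := fun y => F y - S y)
    ((hF.mono hAK).sub hS.1) (hφ.mono (hAK.trans hK0)) (hF.continuousOn.sub hSc)
    (hφ.continuousOn.mono hK0) hpos ?_ (inv_pos.2 hc) hsuper
    (hg.congr_fun (fun x hx => (hlap x hx).symm) hA.measurableSet)
  · rw [setIntegral_congr_fun hA.measurableSet hlap, inv_pow, inv_mul_le_iff₀ (by positivity)] at h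
    exact h
  · intro x hx hxA
    rcases hx.1.eq_or_lt with h | h
    · exact sub_eq_zero.2 (hSa x h.symm).symm
    · rcases hx.2.eq_or_lt with h' | h'
      · exact sub_eq_zero.2 (hSb x h').symm
      · exact absurd ⟨h, h'⟩ hxA

lemma pairwise_disjoint_annulus (d : ℕ) {n : ℕ} {r : Fin (n + 1) → ℝ} (hr : StrictMono r) :
    Pairwise (Function.onFun Disjoint fun i : Fin n => annulus d (r i.castSucc) (r i.succ)) := by
  have hlt : ∀ i j : Fin n, i < j →
      Disjoint (annulus d (r i.castSucc) (r i.succ)) (annulus d (r j.castSucc) (r j.succ)) := by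
    intro i j hij
    refine Set.disjoint_left.2 fun x hx hx' => ?_
    have h : r i.succ ≤ r j.castSucc := hr.monotone (Fin.succ_le_castSucc_iff.2 hij)
    exact lt_irrefl _ (hx.2.trans_le (h.trans hx'.1.le))
  intro i j hij
  rcases lt_or_gt_of_ne hij with h | h
  · exact hlt i j h
  · exact (hlt j i h).symm

/-- Up to the interface spheres, the annulus is the union of its subannuli. -/
lemma annulus_ae_eq_iUnion {d n : ℕ} {r : Fin (n + 1) → ℝ} (hr0 : 0 < r 0)
    (hr : StrictMono r) :
    annulus d (r 0) (r (Fin.last n)) =ᵐ[volume]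
      ⋃ i : Fin n, annulus d (r i.castSucc) (r i.succ) := by
  have hnull : volume (⋃ i, sphere (0 : EuclideanSpace ℝ (Fin d)) (r i)) = 0 := by
    rw [measure_iUnion_null_iff]
    exact fun i => Measure.addHaar_sphere_of_ne_zero _ _
      (hr0.trans_le (hr.monotone (Fin.zero_le i))).ne'
  filter_upwards [compl_mem_ae_iff.2 hnull] with x hx
  have hne : ∀ i, ‖x‖ ≠ r i := fun i h => hx (mem_iUnion.2 ⟨i, by simpa using h⟩)
  refine propext ⟨fun h => ?_, fun h => ?_⟩
  · by_contra hcon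
    have hstep : ∀ i, r i < ‖x‖ := by
      intro i
      induction i using Fin.induction with
      | zero => exact h.1
      | succ i ih =>
        by_contra hi
        exact hcon (mem_iUnion.2 ⟨i, ih, lt_of_le_of_ne (not_lt.1 hi) (hne _)⟩)
    exact lt_asymm (hstep _) h.2
  · obtain ⟨i, hi⟩ := mem_iUnion.1 h
    exact ⟨(hr.monotone (Fin.zero_le _)).trans_lt hi.1,
      hi.2.trans_le (hr.monotone (Fin.le_last _))⟩

/-- `L²` error estimate for interpolation by harmonic splines on an annulus
with concentric annular partition. -/
theorem harmonic_spline_L2_error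
    (d n : ℕ) (hd : 2 ≤ d) (hn : 1 ≤ n) (r : Fin (n + 1) → ℝ)
    (hr0 : 0 < r 0) (hr : StrictMono r)
    (F S : EuclideanSpace ℝ (Fin d) → ℝ)
    (hF : ContDiffOn ℝ 2 F (closedAnnulus d (r 0) (r (Fin.last n))))
    (hS : HarmonicSpline d n r S)
    (hinterp : ∀ (i : Fin (n + 1)) (x : EuclideanSpace ℝ (Fin d)), ‖x‖ = r i → S x = F x) :
    Real.sqrt (∫ x in annulus d (r 0) (r (Fin.last n)), (F x - S x) ^ 2) ≤
      max (1 / (2 * (d : ℝ))) (1 / 8) *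
        (⨆ i : Fin n, (r i.succ - r i.castSucc) ^ 2) *
        Real.sqrt (∫ x in annulus d (r 0) (r (Fin.last n)), (laplacian F x) ^ 2) := by
  have hn0 : Nonempty (Fin n) := ⟨⟨0, hn⟩⟩
  have hlen : ∀ i : Fin n, r i.castSucc < r i.succ := fun i => hr i.castSucc_lt_succ
  have hpos : ∀ i, 0 < r i := fun i => hr0.trans_le (hr.monotone (Fin.zero_le i))
  have hsub : ∀ i : Fin n, closedAnnulus d (r i.castSucc) (r i.succ) ⊆
      closedAnnulus d (r 0) (r (Fin.last n)) := fun i =>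
    closedAnnulus_subset (hr.monotone (Fin.zero_le _)) (hr.monotone (Fin.le_last _))
  have hAK := fun i : Fin n => annulus_subset_closedAnnulus d (r i.castSucc) (r i.succ)
  have hmeas := fun i : Fin n => (isOpen_annulus d (r i.castSucc) (r i.succ)).measurableSet
  have hdisj := pairwise_disjoint_annulus d hr
  have hu : ∀ i : Fin n, IntegrableOn (fun x => (F x - S x) ^ 2)
      (annulus d (r i.castSucc) (r i.succ)) := fun i =>
    (((hF.continuousOn.sub hS.1).pow 2).integrableOn_compact
      (isCompact_closedAnnulus _ _ _)).mono_set ((hAK i).trans (hsub i))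
  have hg : ∀ i : Fin n, IntegrableOn (fun x => laplacian F x ^ 2)
      (annulus d (r i.castSucc) (r i.succ)) := fun i =>
    hF.integrableOn_laplacian_sq (isOpen_annulus _ _ _) (isCompact_closedAnnulus _ _ _)
      ((hAK i).trans (hsub i))
  set C : ℝ := max (1 / (2 * (d : ℝ))) (1 / 8)
  set M : ℝ := ⨆ i : Fin n, (r i.succ - r i.castSucc) ^ 2
  have hC : 0 ≤ C := le_max_of_le_right (by norm_num)
  have hM : ∀ i : Fin n, (r i.succ - r i.castSucc) ^ 2 ≤ M := fun i =>
    le_ciSup (f := fun i : Fin n => (r i.succ - r i.castSucc) ^ 2) (finite_range _).bddAbove i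
  have hM0 : 0 ≤ M := (sq_nonneg _).trans (hM ⟨0, hn⟩)
  have key : ∫ x in annulus d (r 0) (r (Fin.last n)), (F x - S x) ^ 2 ≤
      (C * M) ^ 2 * ∫ x in annulus d (r 0) (r (Fin.last n)), laplacian F x ^ 2 := by
    rw [setIntegral_congr_set (annulus_ae_eq_iUnion hr0 hr),
      setIntegral_congr_set (annulus_ae_eq_iUnion hr0 hr),
      integral_iUnion_fintype hmeas hdisj hu, integral_iUnion_fintype hmeas hdisj hg,
      Finset.mul_sum]
    refine Finset.sum_le_sum fun i _ => ?_
    refine (setIntegral_annulus_sq_sub_le hd (hpos _) (hlen i) (hF.mono (hsub i))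
      (hS.1.mono (hsub i)) (hS.2 i) (hinterp _) (hinterp _)).trans ?_
    have hg0 : 0 ≤ ∫ x in annulus d (r i.castSucc) (r i.succ), laplacian F x ^ 2 :=
      integral_nonneg fun x => sq_nonneg _
    have hMi := hM i
    gcongr
  calc _ ≤ √((C * M) ^ 2 * ∫ x in annulus d (r 0) (r (Fin.last n)), laplacian F x ^ 2) :=
        Real.sqrt_le_sqrt key
    _ = _ := by
        rw [Real.sqrt_mul (sq_nonneg _), Real.sqrt_sq (mul_nonneg hC hM0)]
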